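/- arXiv:2403.19860 — 3 statements merged into one kernel-verified Lean document; each statement's English description precedes it below -/
import Mathlib

section
/- Let μ be a probability measure on ℝ with mean 0 and finite positive variance, and let α ∈ ℝ with α ≠ 0. Let s_α : ℝ → ℝ be the scaling map t ↦ αt. Then the free zero bias commutes with scaling: ((s_α)_*μ)° = (s_α)_*(μ°). -/
open MeasureTheory Complex

/-- The Cauchy transform of a measure on ℝ. -/
noncomputable def cauchy (μ : Measure ℝ) (z : ℂ) : ℂ := ∫ t, (z - (t : ℂ))⁻¹ ∂μ

open scoped BoundedContinuousFunction Topology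
open Filter

lemma fzb_ne {z : ℂ} (hz : z.im ≠ 0) (t : ℝ) : z - (t : ℂ) ≠ 0 := by
  intro h
  apply hz
  have := congrArg Complex.im h
  simpa using this

lemma fzb_bound {z : ℂ} (hz : z.im ≠ 0) (t : ℝ) : ‖(z - (t : ℂ))⁻¹‖ ≤ |z.im|⁻¹ := by
  rw [norm_inv]
  apply inv_anti₀ (abs_pos.mpr hz)
  have := Complex.abs_im_le_norm (z - (t : ℂ))
  simpa using this

lemma fzb_cont {z : ℂ} (hz : z.im ≠ 0) : Continuous (fun t : ℝ => (z - (t : ℂ))⁻¹) :=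
  Continuous.inv₀ (by fun_prop) (fzb_ne hz)

noncomputable def fzbR (z : ℂ) (hz : z.im ≠ 0) : ℝ →ᵇ ℂ :=
  BoundedContinuousFunction.ofNormedAddCommGroup (fun t : ℝ => (z - (t : ℂ))⁻¹)
    (fzb_cont hz) |z.im|⁻¹ (fzb_bound hz)

@[simp] lemma fzbR_apply (z : ℂ) (hz : z.im ≠ 0) (t : ℝ) :
    fzbR z hz t = (z - (t : ℂ))⁻¹ := rfl

def fzbS : Set (ℝ →ᵇ ℂ) := {f | f = 1 ∨ ∃ z hz, f = fzbR z hz}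

noncomputable def fzbV : Submodule ℂ (ℝ →ᵇ ℂ) := (Submodule.span ℂ fzbS).topologicalClosure

lemma fzbV_closed : IsClosed (fzbV : Set (ℝ →ᵇ ℂ)) := Submodule.isClosed_topologicalClosure _

lemma fzbS_sub {f : ℝ →ᵇ ℂ} (hf : f ∈ fzbS) : f ∈ fzbV :=
  Submodule.le_topologicalClosure _ (Submodule.subset_span hf)

lemma fzbR_mem (z : ℂ) (hz : z.im ≠ 0) : fzbR z hz ∈ fzbV := fzbS_sub (Or.inr ⟨z, hz, rfl⟩)

lemma fzbR_resolvent (z w : ℂ) (hz : z.im ≠ 0) (hw : w.im ≠ 0) :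
    fzbR z hz - fzbR w hw = (w - z) • (fzbR z hz * fzbR w hw) := by
  ext t
  have h1 := fzb_ne hz t
  have h2 := fzb_ne hw t
  simp
  field_simp
  ring

lemma fzbR_mul_ne (z w : ℂ) (hz : z.im ≠ 0) (hw : w.im ≠ 0) (h : z ≠ w) :
    fzbR z hz * fzbR w hw ∈ fzbV := by
  have h' : w - z ≠ 0 := sub_ne_zero.mpr h.symm
  have : fzbR z hz * fzbR w hw = (w - z)⁻¹ • (fzbR z hz - fzbR w hw) := by
    rw [fzbR_resolvent, smul_smul, inv_mul_cancel₀ h', one_smul]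
  rw [this]
  exact fzbV.smul_mem _ (fzbV.sub_mem (fzbR_mem _ _) (fzbR_mem _ _))

lemma fzbR_norm (z : ℂ) (hz : z.im ≠ 0) : ‖fzbR z hz‖ ≤ |z.im|⁻¹ :=
  (BoundedContinuousFunction.norm_le (by positivity)).2 (fzb_bound hz)

lemma fzbR_sq (z : ℂ) (hz : z.im ≠ 0) : fzbR z hz * fzbR z hz ∈ fzbV := by
  let s : ℕ → ℝ := fun n => 1 / ((n : ℝ) + 1)
  have hs : ∀ n, 0 < s n := fun n => by positivity
  have him : ∀ n, (z + ((s n : ℝ) : ℂ) * z).im = (1 + s n) * z.im := fun n => by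
    simp; ring
  have hw : ∀ n, (z + ((s n : ℝ) : ℂ) * z).im ≠ 0 := fun n => by
    rw [him]
    have := hs n
    exact mul_ne_zero (by positivity) hz
  have hz0 : z ≠ 0 := by rintro rfl; simp at hz
  have hne : ∀ n, z ≠ z + ((s n : ℝ) : ℂ) * z := fun n h => by
    have h0 : ((s n : ℝ) : ℂ) * z = 0 := by simpa using h
    rcases mul_eq_zero.mp h0 with h1 | h1
    · exact (hs n).ne' (by exact_mod_cast h1)
    · exact hz0 h1
  have hlim : Tendsto (fun n => fzbR (z + ((s n : ℝ) : ℂ) * z) (hw n)) atTop (𝓝 (fzbR z hz)) := by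
    rw [tendsto_iff_norm_sub_tendsto_zero]
    have hs0 : Tendsto s atTop (𝓝 0) := tendsto_one_div_add_atTop_nhds_zero_nat
    have hb : Tendsto (fun n => s n * (‖z‖ * (|z.im|⁻¹ * |z.im|⁻¹))) atTop (𝓝 0) := by
      simpa using hs0.mul_const (‖z‖ * (|z.im|⁻¹ * |z.im|⁻¹))
    refine squeeze_zero (fun n => norm_nonneg _) (fun n => ?_) hb
    rw [fzbR_resolvent, norm_smul]
    have e1 : ‖z - (z + ((s n : ℝ) : ℂ) * z)‖ = s n * ‖z‖ := by
      rw [sub_add_cancel_left, norm_neg, norm_mul, Complex.norm_real, Real.norm_eq_abs,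
        abs_of_pos (hs n)]
    have e2 : ‖fzbR (z + ((s n : ℝ) : ℂ) * z) (hw n)‖ ≤ |z.im|⁻¹ := by
      refine (fzbR_norm _ _).trans ?_
      rw [him, abs_mul]
      apply inv_anti₀ (abs_pos.mpr hz)
      have := hs n
      rw [abs_of_pos (show (0:ℝ) < 1 + s n by positivity)]
      nlinarith [abs_nonneg z.im]
    rw [e1, mul_assoc]
    have := (hs n).le
    gcongr
    refine (norm_mul_le _ _).trans ?_
    gcongr
    exact fzbR_norm _ _
  have := hlim.const_mul (fzbR z hz)
  exact fzbV_closed.mem_of_tendsto this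
    (Eventually.of_forall fun n => fzbR_mul_ne _ _ _ _ (hne n))

lemma fzbS_mul {f g : ℝ →ᵇ ℂ} (hf : f ∈ fzbS) (hg : g ∈ fzbS) : f * g ∈ fzbV := by
  rcases hf with rfl | ⟨z, hz, rfl⟩
  · rw [one_mul]; exact fzbS_sub hg
  rcases hg with rfl | ⟨w, hw, rfl⟩
  · rw [mul_one]; exact fzbR_mem _ _
  by_cases h : z = w
  · subst h; exact fzbR_sq z hz
  · exact fzbR_mul_ne _ _ _ _ h

lemma fzbV_mul {f g : ℝ →ᵇ ℂ} (hf : f ∈ fzbV) (hg : g ∈ fzbV) : f * g ∈ fzbV := by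
  have key : ∀ a ∈ (Submodule.span ℂ fzbS : Set (ℝ →ᵇ ℂ)),
      ∀ b ∈ (Submodule.span ℂ fzbS : Set (ℝ →ᵇ ℂ)), a * b ∈ (fzbV : Set (ℝ →ᵇ ℂ)) := by
    intro a ha b hb
    have h1 : a * b ∈ Submodule.span ℂ fzbS * Submodule.span ℂ fzbS := Submodule.mul_mem_mul ha hb
    rw [Submodule.span_mul_span] at h1
    refine (Submodule.span_le.2 ?_) h1
    rintro _ ⟨x, hx, y, hy, rfl⟩
    exact fzbS_mul hx hy
  have := map_mem_closure₂' (f := fun a b : ℝ →ᵇ ℂ => a * b) (fun x => continuous_const_mul x)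
    (fun x => continuous_mul_const x) hf hg key
  rwa [fzbV_closed.closure_eq] at this

lemma fzbV_star {f : ℝ →ᵇ ℂ} (hf : f ∈ fzbV) : star f ∈ fzbV := by
  refine map_mem_closure continuous_star hf ?_
  intro a ha
  simp only [SetLike.mem_coe] at ha ⊢
  induction ha using Submodule.span_induction with
  | mem x hx =>
    apply Submodule.subset_span
    rcases hx with rfl | ⟨z, hz, rfl⟩
    · left; simp
    · right
      refine ⟨(starRingEnd ℂ) z, by simpa using hz, ?_⟩
      ext t
      simp
  | zero => simp
  | add x y _ _ h1 h2 => rw [star_add]; exact add_mem h1 h2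
  | smul a x _ h => rw [star_smul]; exact Submodule.smul_mem _ _ h

noncomputable def fzbA : StarSubalgebra ℂ (ℝ →ᵇ ℂ) where
  carrier := fzbV
  mul_mem' := fzbV_mul
  add_mem' := fzbV.add_mem
  algebraMap_mem' := fun r => by
    rw [Algebra.algebraMap_eq_smul_one]
    exact fzbV.smul_mem _ (fzbS_sub (Or.inl rfl))
  star_mem' := fzbV_star

lemma fzb_int_cont (P : Measure ℝ) [IsProbabilityMeasure P] :
    Continuous (fun f : ℝ →ᵇ ℂ => ∫ x, f x ∂P) := by
  refine (LipschitzWith.of_dist_le_mul (K := 1) fun f g => ?_).continuous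
  rw [dist_eq_norm, dist_eq_norm, ← integral_sub (f.integrable P) (g.integrable P)]
  simpa using (f - g).norm_integral_le_norm P

lemma fzb_conj (P : Measure ℝ) (z : ℂ) :
    cauchy P ((starRingEnd ℂ) z) = (starRingEnd ℂ) (cauchy P z) := by
  unfold cauchy
  rw [← integral_conj]
  congr 1
  ext t
  simp

lemma fzb_unique (P Q : Measure ℝ) [IsProbabilityMeasure P] [IsProbabilityMeasure Q]
    (h : ∀ z : ℂ, 0 < z.im → cauchy P z = cauchy Q z) : P = Q := by
  have h' : ∀ z : ℂ, z.im ≠ 0 → cauchy P z = cauchy Q z := by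
    intro z hz
    rcases lt_or_gt_of_ne hz with h0 | h0
    · have := h ((starRingEnd ℂ) z) (by simpa using h0)
      rw [fzb_conj, fzb_conj] at this
      exact (starRingEnd ℂ).injective this
    · exact h z h0
  refine ext_of_forall_mem_subalgebra_integral_eq_of_polish (𝕜 := ℂ) (A := fzbA) ?_ ?_
  · intro x y hxy
    have hI : Complex.I.im ≠ 0 := by simp
    refine ⟨fun t => (Complex.I - (t : ℂ))⁻¹, ⟨(fzbR Complex.I hI).toContinuousMap,
      ⟨fzbR Complex.I hI, fzbR_mem _ _, rfl⟩, rfl⟩, ?_⟩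
    intro he
    apply hxy
    have := inv_injective he
    exact_mod_cast sub_right_injective this
  · intro g hg
    have hcl : IsClosed {f : ℝ →ᵇ ℂ | ∫ x, f x ∂P = ∫ x, f x ∂Q} :=
      isClosed_eq (fzb_int_cont P) (fzb_int_cont Q)
    refine closure_minimal ?_ hcl hg
    intro f hf
    simp only [SetLike.mem_coe, Set.mem_setOf_eq] at hf ⊢
    induction hf using Submodule.span_induction with
    | mem x hx =>
      rcases hx with rfl | ⟨z, hz, rfl⟩
      · simp
      · exact h' z hz
    | zero => simp
    | add x y _ _ h1 h2 =>
      simp only [BoundedContinuousFunction.coe_add, Pi.add_apply]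
      rw [integral_add (x.integrable P) (y.integrable P),
        integral_add (x.integrable Q) (y.integrable Q), h1, h2]
    | smul a x _ h =>
      simp only [BoundedContinuousFunction.coe_smul]
      rw [integral_smul, integral_smul, h]

lemma fzb_im_neg (P : Measure ℝ) [IsProbabilityMeasure P] (z : ℂ) (hz : 0 < z.im) :
    (cauchy P z).im < 0 := by
  have hi : Integrable (fun t : ℝ => (z - (t : ℂ))⁻¹) P := (fzbR z hz.ne').integrable P
  have e : (cauchy P z).im = ∫ t, ((z - (t : ℂ))⁻¹).im ∂P := by
    unfold cauchy
    exact (integral_im hi).symm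
  have hpt : ∀ t : ℝ, 0 < -((z - (t : ℂ))⁻¹).im := by
    intro t
    rw [Complex.inv_im]
    have : 0 < Complex.normSq (z - (t : ℂ)) := Complex.normSq_pos.mpr (fzb_ne hz.ne' t)
    simp only [Complex.sub_im, Complex.ofReal_im, sub_zero, neg_div, neg_neg]
    positivity
  have hpos : 0 < ∫ t, -((z - (t : ℂ))⁻¹).im ∂P := by
    rw [integral_pos_iff_support_of_nonneg (fun t => (hpt t).le) hi.im.neg]
    have : Function.support (fun t : ℝ => -((z - (t : ℂ))⁻¹).im) = Set.univ := by
      ext t; simpa using (hpt t).ne'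
    rw [this]; simp
  rw [integral_neg] at hpos
  rw [e]; linarith

lemma fzb_map (P : Measure ℝ) (α : ℝ) (hα : α ≠ 0) (z : ℂ) :
    cauchy (Measure.map (fun t => α * t) P) z = (α : ℂ)⁻¹ * cauchy P (z / α) := by
  unfold cauchy
  have hα' : (α : ℂ) ≠ 0 := by exact_mod_cast hα
  have he : MeasurableEmbedding (fun t : ℝ => α * t) :=
    (Homeomorph.mulLeft₀ α hα).measurableEmbedding
  rw [he.integral_map, ← integral_const_mul]
  congr 1
  ext t
  rw [← mul_inv, mul_sub, mul_div_cancel₀ _ hα']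
  push_cast
  rfl

/-- the free zero bias commutes with scaling by α ≠ 0.  Here ρ₁ is the
free zero bias of the pushforward (s_α)_*μ and ρ₂ is the free zero bias of μ (each
characterized by its defining equation, with the variance written as the second
moment of the corresponding measure); the conclusion is ρ₁ = (s_α)_* ρ₂. -/
theorem freeZeroBias_scaling (μ ρ₁ ρ₂ : Measure ℝ)
    [IsProbabilityMeasure μ] [IsProbabilityMeasure ρ₁] [IsProbabilityMeasure ρ₂]
    (α : ℝ) (hα : α ≠ 0)
    (h1 : Integrable (fun t => t) μ) (hmean : (∫ t, t ∂μ) = 0)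
    (h2 : Integrable (fun t => t ^ 2) μ) (hpos : 0 < ∫ t, t ^ 2 ∂μ)
    (hρ₁ : ∀ z : ℂ, 0 < z.im →
      (cauchy ρ₁ z) ^ 2 = (z * cauchy (Measure.map (fun t => α * t) μ) z - 1)
        / ((∫ t, t ^ 2 ∂(Measure.map (fun t => α * t) μ) : ℝ) : ℂ))
    (hρ₂ : ∀ z : ℂ, 0 < z.im →
      (cauchy ρ₂ z) ^ 2 = (z * cauchy μ z - 1) / ((∫ t, t ^ 2 ∂μ : ℝ) : ℂ)) :
    ρ₁ = Measure.map (fun t => α * t) ρ₂ := by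
  have hα' : (α : ℂ) ≠ 0 := by exact_mod_cast hα
  have hmeas : Measurable (fun t : ℝ => α * t) := by fun_prop
  haveI : IsProbabilityMeasure (Measure.map (fun t => α * t) ρ₂) :=
    Measure.isProbabilityMeasure_map hmeas.aemeasurable
  have hvar : ∫ t, t ^ 2 ∂(Measure.map (fun t => α * t) μ) = α ^ 2 * ∫ t, t ^ 2 ∂μ := by
    rw [integral_map hmeas.aemeasurable (by fun_prop), ← integral_const_mul]
    congr 1
    ext t
    ring
  have hρ₂' : ∀ z : ℂ, z.im ≠ 0 →
      (cauchy ρ₂ z) ^ 2 = (z * cauchy μ z - 1) / ((∫ t, t ^ 2 ∂μ : ℝ) : ℂ) := by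
    intro z hz
    rcases lt_or_gt_of_ne hz with h0 | h0
    · have := hρ₂ ((starRingEnd ℂ) z) (by simpa using h0)
      rw [fzb_conj, fzb_conj] at this
      apply (starRingEnd ℂ).injective
      rw [map_pow, this, map_div₀, map_sub, map_mul, map_one, Complex.conj_ofReal]
    · exact hρ₂ z h0
  apply fzb_unique
  intro z hz
  have hzα : (z / α).im ≠ 0 := by
    rw [Complex.div_ofReal_im]
    exact div_ne_zero hz.ne' hα
  have hσ : ((∫ t, t ^ 2 ∂μ : ℝ) : ℂ) ≠ 0 := by exact_mod_cast hpos.ne'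
  have hsq : (cauchy ρ₁ z) ^ 2 = (cauchy (Measure.map (fun t => α * t) ρ₂) z) ^ 2 := by
    rw [hρ₁ z hz, hvar, fzb_map _ α hα, fzb_map _ α hα, mul_pow, hρ₂' _ hzα]
    rw [Complex.ofReal_mul, Complex.ofReal_pow]
    field_simp
  rcases sq_eq_sq_iff_eq_or_eq_neg.mp hsq with h | h
  · exact h
  · exfalso
    have a := fzb_im_neg ρ₁ z hz
    have b := fzb_im_neg (Measure.map (fun t => α * t) ρ₂) z hz
    rw [h, Complex.neg_im] at a
    linarith
end

section
/- Let μ_n and μ be probability measures on ℝ, each with mean 0 and finite second moment, such that μ_n ⇀ μ weakly and ∫ t² dμ_n(t) → ∫ t² dμ(t) ∈ (0,∞). Then the free zero biases converge weakly: μ_n° ⇀ μ°. -/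
open MeasureTheory Complex Filter Topology

/-- Poisson kernel. -/
noncomputable def poisK (e u : ℝ) : ℝ := Real.pi⁻¹ * e * (u ^ 2 + e ^ 2)⁻¹

lemma poisK_eq (e : ℝ) (he : 0 < e) (_x : ℝ) :
    poisK e = ProbabilityTheory.cauchyPDFReal 0 ⟨e, he.le⟩ := by
  funext u
  simp only [poisK, ProbabilityTheory.cauchyPDFReal, sub_zero]
  rfl

lemma poisK_int (e : ℝ) (he : 0 < e) : Integrable (poisK e) := by
  rw [poisK_eq e he 0]; exact ProbabilityTheory.integrable_cauchyPDFReal 0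

lemma poisK_one (e : ℝ) (he : 0 < e) : ∫ u, poisK e u = 1 := by
  rw [poisK_eq e he 0]
  exact ProbabilityTheory.integral_cauchyPDFReal_eq_one 0 (by
    intro h; have : e = 0 := congrArg NNReal.toReal h; linarith)

lemma poisK_nonneg (e : ℝ) (he : 0 < e) (u : ℝ) : 0 ≤ poisK e u := by
  unfold poisK; positivity

lemma poisK_cont (e : ℝ) (he : 0 < e) : Continuous (poisK e) := by
  unfold poisK
  refine continuous_const.mul (Continuous.inv₀ (by fun_prop) fun x => by positivity)

lemma resolv_cont (z : ℂ) (hz : 0 < z.im) : Continuous (fun t : ℝ => (z - (t : ℂ))⁻¹) := by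
  refine Continuous.inv₀ (by fun_prop) fun x h => ?_
  have := congrArg Complex.im h
  simp at this; linarith

lemma resolv_bound (z : ℂ) (hz : 0 < z.im) (t : ℝ) : ‖(z - (t : ℂ))⁻¹‖ ≤ z.im⁻¹ := by
  rw [norm_inv]
  gcongr
  have := Complex.abs_im_le_norm (z - t)
  simp at this
  exact (le_abs_self _).trans this

/-- resolvent as bounded continuous function -/
noncomputable def resolvB (z : ℂ) (hz : 0 < z.im) : BoundedContinuousFunction ℝ ℂ :=
  BoundedContinuousFunction.ofNormedAddCommGroup (fun t : ℝ => (z - (t : ℂ))⁻¹)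
    (resolv_cont z hz) z.im⁻¹ (resolv_bound z hz)

lemma resolv_integrable (ν : Measure ℝ) [IsProbabilityMeasure ν] (z : ℂ) (hz : 0 < z.im) :
    Integrable (fun t : ℝ => (z - (t : ℂ))⁻¹) ν :=
  (resolvB z hz).integrable ν

lemma resolv_im (z : ℂ) (t : ℝ) :
    ((z - (t : ℂ))⁻¹).im = - (Real.pi * poisK z.im (z.re - t)) := by
  simp only [Complex.inv_im, Complex.normSq_apply, poisK]
  have := Real.pi_ne_zero
  simp
  field_simp

lemma cauchy_im (ν : Measure ℝ) [IsProbabilityMeasure ν] (z : ℂ) (hz : 0 < z.im) :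
    (cauchy ν z).im = - (Real.pi * ∫ t, poisK z.im (z.re - t) ∂ν) := by
  have := integral_im (𝕜 := ℂ) (resolv_integrable ν z hz)
  simp only [RCLike.im_eq_complex_im] at this
  rw [cauchy, ← this]
  simp_rw [resolv_im]
  rw [integral_neg, integral_const_mul]

lemma poisK_bound (e : ℝ) (he : 0 < e) (u : ℝ) : poisK e u ≤ Real.pi⁻¹ * e⁻¹ := by
  unfold poisK
  have : (u ^ 2 + e ^ 2)⁻¹ ≤ (e^2)⁻¹ := by gcongr; nlinarith
  calc _ ≤ Real.pi⁻¹ * e * (e^2)⁻¹ := by gcongr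
    _ = _ := by field_simp

lemma poisK_intν (ν : Measure ℝ) [IsProbabilityMeasure ν] (e : ℝ) (he : 0 < e) (x : ℝ) :
    Integrable (fun t => poisK e (x - t)) ν := by
  refine Integrable.of_bound (C := Real.pi⁻¹ * e⁻¹)
    ((poisK_cont e he).comp (by fun_prop)).aestronglyMeasurable (ae_of_all _ fun t => ?_)
  rw [Real.norm_of_nonneg (poisK_nonneg e he _)]
  exact poisK_bound e he _

lemma cauchy_im_neg (ν : Measure ℝ) [IsProbabilityMeasure ν] (z : ℂ) (hz : 0 < z.im) :
    (cauchy ν z).im < 0 := by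
  rw [cauchy_im ν z hz]
  have : 0 < ∫ t, poisK z.im (z.re - t) ∂ν := by
    rw [integral_pos_iff_support_of_nonneg (fun t => poisK_nonneg _ hz _) (poisK_intν ν _ hz _)]
    have : Function.support (fun t => poisK z.im (z.re - t)) = Set.univ := by
      ext t
      simp only [Function.mem_support, Set.mem_univ, iff_true]
      unfold poisK; positivity
    rw [this]; simp
  have := Real.pi_pos
  have : 0 < Real.pi * ∫ t, poisK z.im (z.re - t) ∂ν := by positivity
  linarith

lemma sqrt_tendsto (w : ℕ → ℂ) (w₀ : ℂ) (hw : ∀ n, (w n).im < 0) (hw₀ : w₀.im < 0)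
    (h : Tendsto (fun n => w n ^ 2) atTop (𝓝 (w₀ ^ 2))) : Tendsto w atTop (𝓝 w₀) := by
  rw [tendsto_iff_norm_sub_tendsto_zero] at h ⊢
  have h' := h.const_mul (-w₀.im)⁻¹
  rw [mul_zero] at h'
  refine squeeze_zero (fun n => norm_nonneg _) (fun n => ?_) h'
  have h1 : w n ^ 2 - w₀ ^ 2 = (w n + w₀) * (w n - w₀) := by ring
  have h2 : -w₀.im ≤ ‖w n + w₀‖ := by
    have := Complex.abs_im_le_norm (w n + w₀)
    have h3 := neg_le_abs (w n + w₀).im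
    simp at h3 this
    linarith [hw n]
  rw [h1, norm_mul, inv_mul_eq_div, le_div_iff₀ (by linarith), mul_comm]
  gcongr

lemma prod_integrable (ν : Measure ℝ) [IsProbabilityMeasure ν] (e : ℝ) (he : 0 < e)
    (f : ℝ → ℝ) (hf : Continuous f) (M : ℝ) (hM : ∀ x, |f x| ≤ M) :
    Integrable (Function.uncurry fun x t => f x * poisK e (x - t)) (volume.prod ν) := by
  have hb : Integrable (fun q : ℝ × ℝ => poisK e (q.1 - q.2)) (volume.prod ν) := by
    have hc : Continuous (fun q : ℝ × ℝ => poisK e (q.1 - q.2)) :=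
      (poisK_cont e he).comp (by fun_prop)
    rw [integrable_prod_iff' hc.aestronglyMeasurable]
    refine ⟨ae_of_all _ fun t => (poisK_int e he).comp_sub_right t, ?_⟩
    have : (fun y => ∫ x, ‖poisK e (x - y)‖) = fun _ => 1 := by
      funext y
      simp_rw [Real.norm_of_nonneg (poisK_nonneg e he _)]
      rw [integral_sub_right_eq_self (poisK e) y, poisK_one e he]
    simp only [this]
    exact integrable_const _
  exact hb.bdd_mul (c := M) (f := fun q : ℝ × ℝ => f q.1)
    (hf.comp continuous_fst).aestronglyMeasurable (ae_of_all _ fun q => hM q.1)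

lemma fubini (ν : Measure ℝ) [IsProbabilityMeasure ν] (e : ℝ) (he : 0 < e)
    (f : ℝ → ℝ) (hf : Continuous f) (M : ℝ) (hM : ∀ x, |f x| ≤ M) :
    ∫ x, f x * ∫ t, poisK e (x - t) ∂ν = ∫ t, (∫ u, f (u + t) * poisK e u) ∂ν := by
  simp_rw [← integral_const_mul]
  rw [integral_integral_swap (prod_integrable ν e he f hf M hM)]
  congr 1
  funext t
  rw [← integral_add_right_eq_self _ t]
  simp

lemma dens_int (ν : Measure ℝ) [IsProbabilityMeasure ν] (e : ℝ) (he : 0 < e) :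
    Integrable (fun x => ∫ t, poisK e (x - t) ∂ν) := by
  have := (prod_integrable ν e he (fun _ => 1) continuous_const 1 (by simp)).integral_prod_left
  simpa [Function.uncurry] using this

lemma dens_one (ν : Measure ℝ) [IsProbabilityMeasure ν] (e : ℝ) (he : 0 < e) :
    ∫ x, ∫ t, poisK e (x - t) ∂ν = 1 := by
  have := fubini ν e he (fun _ => 1) continuous_const 1 (by simp)
  simpa [poisK_one e he] using this

lemma scheffe (p : ℕ → ℝ → ℝ) (q : ℝ → ℝ) (hp0 : ∀ n x, 0 ≤ p n x) (hq0 : ∀ x, 0 ≤ q x)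
    (hpi : ∀ n, Integrable (p n)) (hqi : Integrable q) (hp1 : ∀ n, ∫ x, p n x = 1)
    (hq1 : ∫ x, q x = 1) (h : ∀ x, Tendsto (fun n => p n x) atTop (𝓝 (q x))) :
    Tendsto (fun n => ∫ x, |p n x - q x|) atTop (𝓝 0) := by
  have key : ∀ n, ∫ x, |p n x - q x| = 2 * ∫ x, max (q x - p n x) 0 := by
    intro n
    have hi : Integrable (fun x => max (q x - p n x) 0) := (hqi.sub (hpi n)).pos_part
    have : ∀ x, |p n x - q x| = 2 * max (q x - p n x) 0 + (p n x - q x) := by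
      intro x
      rcases le_total (p n x) (q x) with h | h
      · rw [max_eq_left (by linarith), abs_of_nonpos (by linarith)]; ring
      · rw [max_eq_right (by linarith), abs_of_nonneg (by linarith)]; ring
    simp_rw [this]
    have hd : Integrable (fun x => p n x - q x) := (hpi n).sub hqi
    rw [integral_add (hi.const_mul 2) hd, integral_const_mul,
      integral_sub (hpi n) hqi, hp1, hq1]
    ring
  simp_rw [key]
  have : Tendsto (fun n => ∫ x, max (q x - p n x) 0) atTop (𝓝 (∫ _ : ℝ, (0:ℝ))) := by
    refine tendsto_integral_of_dominated_convergence q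
      (fun n => ((hqi.sub (hpi n)).pos_part).aestronglyMeasurable) hqi
      (fun n => ae_of_all _ fun x => ?_) (ae_of_all _ fun x => ?_)
    · rw [Real.norm_of_nonneg (le_max_right _ _)]
      exact max_le (by linarith [hp0 n x]) (hq0 x)
    · have := ((h x).const_sub (q x)).max (tendsto_const_nhds (x := (0:ℝ)))
      simpa using this
  simpa using this.const_mul 2

lemma delta_bound (L C e u : ℝ) (hL : 0 ≤ L) (hC : 0 ≤ C) (he : 0 < e) (he1 : e ≤ 1) :
    min (L * |u|) C * poisK e u ≤ (Real.pi⁻¹ * (L + 2 * C)) * (1 + u ^ 2)⁻¹ := by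
  unfold poisK
  have hpi := Real.pi_pos
  have h : min (L * |u|) C * (e * (u^2+e^2)⁻¹) ≤ (L + 2 * C) * (1 + u ^ 2)⁻¹ := by
    rw [← div_eq_mul_inv, ← div_eq_mul_inv, mul_div_assoc', div_le_div_iff₀ (by positivity) (by positivity)]
    rw [← sq_abs u]
    have hu := abs_nonneg u
    set a := |u|
    rcases le_total a 1 with h1 | h1
    · have : min (L * a) C ≤ L * a := min_le_left _ _
      calc _ ≤ L * a * e * (1 + a^2) := by gcongr
        _ ≤ L * (a * e * 2) := by
            have : a * e * (1 + a^2) ≤ a * e * 2 := by gcongr; nlinarith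
            nlinarith
        _ ≤ L * (a^2+e^2) := by gcongr; nlinarith [sq_nonneg (a-e)]
        _ ≤ _ := by gcongr; linarith
    · have : min (L * a) C ≤ C := min_le_right _ _
      calc _ ≤ C * 1 * (1 + a^2) := by gcongr
        _ ≤ (2 * C) * (a^2+e^2) := by nlinarith [mul_nonneg hC (sq_nonneg e), mul_nonneg hC (by nlinarith : 0 ≤ a^2-1)]
        _ ≤ _ := by gcongr; linarith
  calc _ = Real.pi⁻¹ * (min (L * |u|) C * (e * (u^2+e^2)⁻¹)) := by ring
    _ ≤ Real.pi⁻¹ * ((L + 2 * C) * (1 + u ^ 2)⁻¹) := by gcongr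
    _ = _ := by ring

lemma delta_int (L C e : ℝ) (hL : 0 ≤ L) (hC : 0 ≤ C) (he : 0 < e) :
    Integrable (fun u => min (L * |u|) C * poisK e u) := by
  refine (poisK_int e he).bdd_mul (c := C) (by fun_prop) (ae_of_all _ fun u => ?_)
  rw [Real.norm_of_nonneg (by positivity)]
  exact min_le_right _ _

lemma delta_tendsto (L C : ℝ) (hL : 0 ≤ L) (hC : 0 ≤ C) :
    Tendsto (fun e => ∫ u, min (L * |u|) C * poisK e u) (𝓝[>] 0) (𝓝 0) := by
  have hev : ∀ᶠ e : ℝ in 𝓝[>] 0, 0 < e ∧ e ≤ 1 := by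
    filter_upwards [Ioc_mem_nhdsGT (zero_lt_one' ℝ)] with e he using he
  have : Tendsto (fun e => ∫ u, min (L * |u|) C * poisK e u) (𝓝[>] 0) (𝓝 (∫ _ : ℝ, (0:ℝ))) := by
    refine tendsto_integral_filter_of_dominated_convergence
      (fun u => (Real.pi⁻¹ * (L + 2 * C)) * (1 + u ^ 2)⁻¹) ?_ ?_
      (integrable_inv_one_add_sq.const_mul _) (ae_of_all _ fun u => ?_)
    · filter_upwards [hev] with e he using (delta_int L C e hL hC he.1).aestronglyMeasurable
    · filter_upwards [hev] with e he
      refine ae_of_all _ fun u => ?_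
      rw [Real.norm_of_nonneg (mul_nonneg (by positivity) (poisK_nonneg e he.1 u))]
      exact delta_bound L C e u hL hC he.1 he.2
    · by_cases hu : u = 0
      · subst hu; simp [hC]
      · refine Tendsto.mono_left ?_ nhdsWithin_le_nhds
        have : ContinuousAt (fun e => min (L * |u|) C * poisK e u) 0 := by
          unfold poisK
          have : u ^ 2 + (0:ℝ) ^ 2 ≠ 0 := by positivity
          fun_prop (disch := assumption)
        simpa [ContinuousAt, poisK] using this
  simpa using this

lemma smooth_err (ν : Measure ℝ) [IsProbabilityMeasure ν] (e : ℝ) (he : 0 < e)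
    (f : ℝ → ℝ) (hf : Continuous f) (M : ℝ) (hM : ∀ x, |f x| ≤ M)
    (L C : ℝ) (hL : 0 ≤ L) (hC : 0 ≤ C)
    (hfL : ∀ x y, |f x - f y| ≤ L * |x - y|) (hfC : ∀ x y, |f x - f y| ≤ C) :
    |(∫ x, f x * ∫ t, poisK e (x - t) ∂ν) - ∫ t, f t ∂ν| ≤ ∫ u, min (L * |u|) C * poisK e u := by
  rw [fubini ν e he f hf M hM]
  have hi1 : Integrable (fun t => ∫ u, f (u + t) * poisK e u) ν := by
    have := (prod_integrable ν e he f hf M hM).integral_prod_right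
    refine this.congr (ae_of_all _ fun t => ?_)
    simp only [Function.uncurry]
    rw [← integral_add_right_eq_self _ t]
    simp
  have hi2 : Integrable f ν := Integrable.of_bound hf.aestronglyMeasurable M (ae_of_all _ hM)
  rw [← integral_sub hi1 hi2]
  have hpt : ∀ t, ‖(∫ u, f (u + t) * poisK e u) - f t‖ ≤ ∫ u, min (L * |u|) C * poisK e u := by
    intro t
    have h1 : f t = ∫ u, f t * poisK e u := by rw [integral_const_mul, poisK_one e he, mul_one]
    have hi3 : Integrable (fun u => f (u + t) * poisK e u) :=
      (poisK_int e he).bdd_mul (c := M) (hf.comp (by fun_prop)).aestronglyMeasurable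
        (ae_of_all _ fun u => hM _)
    conv_lhs => rw [h1]
    rw [← integral_sub hi3 ((poisK_int e he).const_mul _)]
    refine norm_integral_le_of_norm_le (delta_int L C e hL hC he) (ae_of_all _ fun u => ?_)
    rw [← sub_mul, norm_mul, Real.norm_of_nonneg (poisK_nonneg e he u)]
    refine mul_le_mul_of_nonneg_right (le_min ?_ (hfC _ _)) (poisK_nonneg e he u)
    simpa using hfL (u + t) t
  have := norm_integral_le_of_norm_le_const (μ := ν) (ae_of_all _ hpt)
  simpa using this

lemma cauchy_tendsto_weak (ρn : ℕ → Measure ℝ) (ρ : Measure ℝ)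
    [∀ n, IsProbabilityMeasure (ρn n)] [IsProbabilityMeasure ρ]
    (h : ∀ z : ℂ, 0 < z.im → Tendsto (fun n => cauchy (ρn n) z) atTop (𝓝 (cauchy ρ z)))
    (f : ℝ → ℝ) (C L : ℝ) (hL : 0 ≤ L) (hfC : ∀ x y, |f x - f y| ≤ C)
    (hfL : ∀ x y, |f x - f y| ≤ L * |x - y|) (hf : Continuous f) :
    Tendsto (fun n => ∫ x, f x ∂(ρn n)) atTop (𝓝 (∫ x, f x ∂ρ)) := by
  have hC : 0 ≤ C := (abs_nonneg _).trans (hfC 0 0)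
  set M := |f 0| + C
  have hM : ∀ x, |f x| ≤ M := fun x => by
    have h1 := hfC x 0
    have h2 := abs_add_le (f x - f 0) (f 0)
    simp only [sub_add_cancel] at h2
    simp only [M]; linarith
  have hM0 : 0 ≤ M := (abs_nonneg _).trans (hM 0)
  have hdens : ∀ e x : ℝ, 0 < e → Tendsto (fun n => ∫ t, poisK e (x - t) ∂(ρn n)) atTop
      (𝓝 (∫ t, poisK e (x - t) ∂ρ)) := by
    intro e x he
    have hz : 0 < (⟨x, e⟩ : ℂ).im := he
    have h1 := (Complex.continuous_im.tendsto _).comp (h ⟨x, e⟩ hz)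
    have h2 := h1.const_mul (-Real.pi⁻¹)
    simp only [Function.comp_def, cauchy_im _ _ hz] at h2
    have hpi := Real.pi_ne_zero
    simpa [hpi] using h2
  have hsm : ∀ e : ℝ, 0 < e → Tendsto (fun n => ∫ x, f x * ∫ t, poisK e (x - t) ∂(ρn n)) atTop
      (𝓝 (∫ x, f x * ∫ t, poisK e (x - t) ∂ρ)) := by
    intro e he
    have hs := scheffe (fun n x => ∫ t, poisK e (x - t) ∂(ρn n)) (fun x => ∫ t, poisK e (x - t) ∂ρ)
      (fun n x => integral_nonneg fun t => poisK_nonneg e he _)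
      (fun x => integral_nonneg fun t => poisK_nonneg e he _)
      (fun n => dens_int _ e he) (dens_int _ e he) (fun n => dens_one _ e he) (dens_one _ e he)
      (fun x => hdens e x he)
    rw [tendsto_iff_norm_sub_tendsto_zero]
    have hs' := hs.const_mul M
    rw [mul_zero] at hs'
    refine squeeze_zero (fun n => norm_nonneg _) (fun n => ?_) hs'
    have hi : ∀ (ν : Measure ℝ) [IsProbabilityMeasure ν],
        Integrable (fun x => f x * ∫ t, poisK e (x - t) ∂ν) := fun ν _ =>
      (dens_int ν e he).bdd_mul (c := M) hf.aestronglyMeasurable (ae_of_all _ hM)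
    rw [← integral_sub (hi _) (hi _), ← integral_const_mul]
    refine norm_integral_le_of_norm_le
      (((dens_int (ρn n) e he).sub (dens_int ρ e he)).abs.const_mul M) (ae_of_all _ fun x => ?_)
    rw [← mul_sub, norm_mul]
    exact mul_le_mul_of_nonneg_right (hM x) (abs_nonneg _)
  rw [Metric.tendsto_atTop]
  intro η hη
  have hd := (delta_tendsto L C hL hC).eventually_lt_const (show 0 < η / 3 by positivity)
  obtain ⟨e, hde, he⟩ := (hd.and self_mem_nhdsWithin).exists
  obtain ⟨N, hN⟩ := Metric.tendsto_atTop.1 (hsm e he) (η / 3) (by positivity)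
  refine ⟨N, fun n hn => ?_⟩
  have h1 := hN n hn
  have h2 := (smooth_err (ρn n) e he f hf M hM L C hL hC hfL hfC).trans_lt hde
  have h3 := (smooth_err ρ e he f hf M hM L C hL hC hfL hfC).trans_lt hde
  rw [Real.dist_eq] at *
  rw [abs_lt] at *
  constructor <;> linarith [h1.1, h1.2, h2.1, h2.2, h3.1, h3.2]

/-- if μₙ ⇀ μ weakly (all with mean 0 and finite second moments) and the
second moments converge to a positive finite limit, then the free zero biases (given by
their defining equations) converge weakly: μₙ° ⇀ μ°. -/
theorem freeZeroBias_weak_continuous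
    (μn ρn : ℕ → Measure ℝ) (μ ρ : Measure ℝ)
    [∀ n, IsProbabilityMeasure (μn n)] [∀ n, IsProbabilityMeasure (ρn n)]
    [IsProbabilityMeasure μ] [IsProbabilityMeasure ρ]
    (hn1 : ∀ n, Integrable (fun t => t) (μn n)) (hnmean : ∀ n, (∫ t, t ∂(μn n)) = 0)
    (hn2 : ∀ n, Integrable (fun t => t ^ 2) (μn n))
    (h1 : Integrable (fun t => t) μ) (hmean : (∫ t, t ∂μ) = 0)
    (h2 : Integrable (fun t => t ^ 2) μ)
    (hweak : ∀ f : BoundedContinuousFunction ℝ ℝ,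
      Tendsto (fun n => ∫ x, f x ∂(μn n)) atTop (𝓝 (∫ x, f x ∂μ)))
    (hmom : Tendsto (fun n => ∫ t, t ^ 2 ∂(μn n)) atTop (𝓝 (∫ t, t ^ 2 ∂μ)))
    (hpos : 0 < ∫ t, t ^ 2 ∂μ)
    (hρn : ∀ n, ∀ z : ℂ, 0 < z.im →
      (cauchy (ρn n) z) ^ 2 = (z * cauchy (μn n) z - 1) / ((∫ t, t ^ 2 ∂(μn n) : ℝ) : ℂ))
    (hρ : ∀ z : ℂ, 0 < z.im →
      (cauchy ρ z) ^ 2 = (z * cauchy μ z - 1) / ((∫ t, t ^ 2 ∂μ : ℝ) : ℂ)) :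
    ∀ f : BoundedContinuousFunction ℝ ℝ,
      Tendsto (fun n => ∫ x, f x ∂(ρn n)) atTop (𝓝 (∫ x, f x ∂ρ)) := by
  have hμ : Tendsto (β := ProbabilityMeasure ℝ) (fun n => ⟨μn n, inferInstance⟩) atTop
      (@nhds (ProbabilityMeasure ℝ) _ ⟨μ, inferInstance⟩) :=
    ProbabilityMeasure.tendsto_iff_forall_integral_tendsto.2 hweak
  have hG : ∀ z : ℂ, 0 < z.im → Tendsto (fun n => cauchy (μn n) z) atTop (𝓝 (cauchy μ z)) :=
    fun z hz => (ProbabilityMeasure.tendsto_iff_forall_integral_rclike_tendsto ℂ).1 hμ (resolvB z hz)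
  have hGρ : ∀ z : ℂ, 0 < z.im → Tendsto (fun n => cauchy (ρn n) z) atTop (𝓝 (cauchy ρ z)) := by
    intro z hz
    refine sqrt_tendsto _ _ (fun n => cauchy_im_neg _ z hz) (cauchy_im_neg _ z hz) ?_
    simp_rw [hρn _ z hz, hρ z hz]
    refine Tendsto.div (((hG z hz).const_mul z).sub_const 1) ?_ ?_
    · exact (Complex.continuous_ofReal.tendsto _).comp hmom
    · exact_mod_cast hpos.ne'
  have hfin : Tendsto (β := ProbabilityMeasure ℝ) (fun n => ⟨ρn n, inferInstance⟩) atTop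
      (@nhds (ProbabilityMeasure ℝ) _ ⟨ρ, inferInstance⟩) := by
    refine tendsto_iff_forall_lipschitz_integral_tendsto.2 ?_
    rintro f ⟨C, hC⟩ ⟨L, hL⟩
    exact cauchy_tendsto_weak ρn ρ hGρ f C L L.2 hC (fun x y => hL.dist_le_mul x y) hL.continuous
  exact ProbabilityMeasure.tendsto_iff_forall_integral_tendsto.1 hfin
end

section
/- Let μ be a probability measure on ℝ with mean 0 and variance σ² ∈ (0,∞), let μ° be its free zero bias, and let ν be the pushforward of the product measure (Lebesgue measure on [0,1]) ⊗ μ° ⊗ μ° under the map (u,w,x) ↦ u·w + (1−u)·x. Then ν satisfies the classical zero bias identity for μ: for every f ∈ C_c^∞(ℝ), ∫ℝ x·f(x) dμ(x) = σ² · ∫ℝ f′(t) dν(t). That is, the classical zero bias of μ is the law of U·W° + (1−U)·X°, where U is uniform on [0,1] and W°, X° are independent with law μ°, all mutually independent. -/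
open MeasureTheory Complex

open Filter Topology

lemma zb_ne (z : ℂ) (hz : 0 < z.im) (t : ℝ) : z - (t : ℂ) ≠ 0 := by
  intro h
  have := congrArg Complex.im h
  simp at this
  exact hz.ne' this

lemma zb_bound (z : ℂ) (hz : 0 < z.im) (t : ℝ) (n : ℕ) :
    ‖((z - (t : ℂ))⁻¹) ^ n‖ ≤ (z.im⁻¹) ^ n := by
  rw [norm_pow, norm_inv]
  have : z.im ≤ ‖z - (t : ℂ)‖ := by
    have := Complex.abs_im_le_norm (z - t)
    simp at this
    exact (le_abs_self _).trans this
  gcongr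

lemma zb_cont (z : ℂ) (hz : 0 < z.im) (n : ℕ) :
    Continuous (fun t : ℝ => ((z - (t : ℂ))⁻¹) ^ n) := by
  apply Continuous.pow
  apply Continuous.inv₀ (by fun_prop)
  exact zb_ne z hz

lemma zb_int (m : Measure ℝ) [IsFiniteMeasure m] (z : ℂ) (hz : 0 < z.im) (n : ℕ) :
    Integrable (fun t : ℝ => ((z - (t : ℂ))⁻¹) ^ n) m :=
  Integrable.of_bound (zb_cont z hz n).aestronglyMeasurable _
    (ae_of_all _ fun t => zb_bound z hz t n)

lemma zb_mul_int (m : Measure ℝ) (a : ℝ → ℝ) (ha : Integrable a m)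
    (z : ℂ) (hz : 0 < z.im) (n : ℕ) :
    Integrable (fun t : ℝ => ((z - (t : ℂ))⁻¹) ^ n * (a t : ℂ)) m :=
  ha.ofReal.bdd_mul (zb_cont z hz n).aestronglyMeasurable
    (ae_of_all _ fun t => zb_bound z hz t n)

lemma zb_L1 (μ : Measure ℝ) [IsProbabilityMeasure μ] (z : ℂ) (hz : 0 < z.im) :
    z * cauchy μ z - 1 = ∫ t, ((z - (t : ℂ))⁻¹) ^ 1 * (t : ℂ) ∂μ := by
  have h := zb_int μ z hz 1
  simp only [pow_one] at h ⊢
  have e : (fun t : ℝ => (z - (t : ℂ))⁻¹ * (t : ℂ)) = fun t : ℝ => z * (z - (t : ℂ))⁻¹ - 1 := by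
    funext t
    have := zb_ne z hz t
    field_simp
    ring
  rw [e, integral_sub (h.const_mul z) (integrable_const _), integral_const_mul]
  simp [cauchy]

lemma zb_seg (z : ℂ) (hz : 0 < z.im) (w x : ℝ) :
    ∫ u in Set.Icc (0 : ℝ) 1, ((z - ((u * w + (1 - u) * x : ℝ) : ℂ))⁻¹) ^ 2
      = (z - (w : ℂ))⁻¹ * (z - (x : ℂ))⁻¹ := by
  rw [integral_Icc_eq_integral_Ioc, ← intervalIntegral.integral_of_le zero_le_one]
  have hx := zb_ne z hz x
  have hw := zb_ne z hz w
  rw [intervalIntegral.integral_eq_sub_of_hasDerivAt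
    (f := fun u : ℝ => (u : ℂ) / ((z - x) * (z - ((u * w + (1 - u) * x : ℝ) : ℂ))))]
  · push_cast
    simp only [zero_div, sub_zero, one_mul, sub_self, zero_mul, add_zero]
    field_simp
  · intro u _
    have hD := zb_ne z hz (u * w + (1 - u) * x)
    have h0 : HasDerivAt (fun u : ℝ => (u : ℂ)) 1 u := by
      simpa using (hasDerivAt_id u).ofReal_comp
    have h1 : HasDerivAt (fun u : ℝ => (z - x) * (z - ((u * w + (1 - u) * x : ℝ) : ℂ)))
        ((z - x) * (-((w : ℂ) - x))) u := by
      have h2 := (((h0.mul_const (w : ℂ)).add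
        ((h0.const_sub 1).mul_const (x : ℂ))).const_sub z).const_mul (z - x)
      have e : (fun u : ℝ => (z - x) * (z - ((u * w + (1 - u) * x : ℝ) : ℂ))) =
          fun u : ℝ => (z - x) * (z - ((u : ℂ) * w + (1 - (u : ℂ)) * x)) := by
        funext v
        push_cast
        rfl
      rw [e]
      exact h2.congr_deriv (by ring)
    have h3 := h0.div h1 (mul_ne_zero hx hD)
    refine h3.congr_deriv ?_
    push_cast at hD ⊢
    field_simp
    ring
  · apply Continuous.intervalIntegrable
    exact (zb_cont z hz 2).comp (by fun_prop : Continuous fun u : ℝ => u * w + (1 - u) * x)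

lemma zb_L2 (ρ : Measure ℝ) [IsProbabilityMeasure ρ] (z : ℂ) (hz : 0 < z.im) :
    (cauchy ρ z) ^ 2 = ∫ t, ((z - (t : ℂ))⁻¹) ^ 2
      ∂(Measure.map (fun p : ℝ × ℝ × ℝ => p.1 * p.2.1 + (1 - p.1) * p.2.2)
      ((volume.restrict (Set.Icc (0 : ℝ) 1)).prod (ρ.prod ρ))) := by
  have hc : Continuous (fun p : ℝ × ℝ × ℝ => p.1 * p.2.1 + (1 - p.1) * p.2.2) := by fun_prop
  rw [integral_map hc.aemeasurable (zb_cont z hz 2).aestronglyMeasurable]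
  rw [integral_prod_symm]
  · simp only [zb_seg z hz]
    rw [integral_prod_mul (fun w : ℝ => (z - (w : ℂ))⁻¹) (fun w : ℝ => (z - (w : ℂ))⁻¹), sq]
    rfl
  · exact Integrable.of_bound ((zb_cont z hz 2).comp hc).aestronglyMeasurable _
      (ae_of_all _ fun t => zb_bound z hz _ 2)

/-- Imaginary part kernel. -/
noncomputable def zbK (n : ℕ) (y x t : ℝ) : ℝ := ((((x : ℂ) + y * I - (t : ℂ))⁻¹) ^ n).im

lemma zbK_cont (n : ℕ) (y : ℝ) (hy : 0 < y) :
    Continuous (fun p : ℝ × ℝ => zbK n y p.1 p.2) := by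
  unfold zbK
  apply Complex.continuous_im.comp
  apply Continuous.pow
  apply Continuous.inv₀ (by fun_prop)
  intro p
  exact zb_ne _ (by simpa using hy) _

lemma zbK_bound (n : ℕ) (y : ℝ) (hy : 0 < y) (x t : ℝ) : ‖zbK n y x t‖ ≤ (y⁻¹) ^ n := by
  have := zb_bound ((x : ℂ) + y * I) (by simpa using hy) t n
  simp only [add_im, ofReal_im, mul_im, ofReal_re, I_im, I_re, mul_one, mul_zero, zero_add,
    add_zero] at this
  exact (Complex.abs_im_le_norm _).trans this

lemma zbK_one (y x t : ℝ) : zbK 1 y x t = - (y / ((x - t) ^ 2 + y ^ 2)) := by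
  simp [zbK, Complex.inv_im, Complex.normSq_apply]
  ring

lemma zbK_int (m : Measure ℝ) (a : ℝ → ℝ) (ha : Integrable a m) (n : ℕ) (y : ℝ) (hy : 0 < y)
    (x : ℝ) : ∫ t, zbK n y x t * a t ∂m
      = (∫ t, (((x : ℂ) + y * I - (t : ℂ))⁻¹) ^ n * (a t : ℂ) ∂m).im := by
  have h := zb_mul_int m a ha ((x : ℂ) + y * I) (by simpa using hy) n
  have := Complex.imCLM.integral_comp_comm h
  simp only [imCLM_apply] at this
  rw [← this]
  simp [zbK]

lemma zbK_deriv (y : ℝ) (hy : 0 < y) (x t : ℝ) :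
    HasDerivAt (fun x => zbK 1 y x t) (-zbK 2 y x t) x := by
  have h0 : HasDerivAt (fun u : ℝ => (u : ℂ)) 1 x := by
    simpa using (hasDerivAt_id x).ofReal_comp
  have h1 := ((h0.add_const (y * I : ℂ)).sub_const (t : ℂ)).inv
    (zb_ne _ (by simpa using hy) _)
  have h2 := Complex.imCLM.hasFDerivAt.comp_hasDerivAt x h1
  have e : (fun x => zbK 1 y x t) = fun x : ℝ => imCLM (((x : ℂ) + y * I - (t : ℂ))⁻¹) := by
    funext u
    simp [zbK]
  rw [e]
  refine HasDerivAt.congr_deriv h2 ?_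
  · simp only [zbK, imCLM_apply]
    rw [← Complex.neg_im]
    congr 1
    rw [inv_pow, neg_div, one_div]

lemma zb_fub (m : Measure ℝ) [IsFiniteMeasure m] (a : ℝ → ℝ) (ha : Integrable a m)
    (g : ℝ → ℝ) (hg : Integrable g) (n : ℕ) (y : ℝ) (hy : 0 < y) :
    ∫ x, g x * (∫ t, zbK n y x t * a t ∂m) = ∫ t, a t * (∫ x, g x * zbK n y x t) ∂m := by
  have h : Integrable (Function.uncurry fun x t => zbK n y x t * (g x * a t))
      ((volume : Measure ℝ).prod m) :=
    (hg.mul_prod ha).bdd_mul (zbK_cont n y hy).aestronglyMeasurable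
      (ae_of_all _ fun p => zbK_bound n y hy _ _)
  have := integral_integral_swap h
  simp only [← integral_const_mul]
  refine Eq.trans ?_ (this.trans ?_)
  · refine integral_congr_ae (ae_of_all _ fun x => integral_congr_ae (ae_of_all _ fun t => ?_))
    simp only
    ring
  · refine integral_congr_ae (ae_of_all _ fun x => integral_congr_ae (ae_of_all _ fun t => ?_))
    simp only
    ring

lemma zb_scale (g : ℝ → ℝ) (y : ℝ) (hy : 0 < y) (t : ℝ) :
    ∫ x, g x * zbK 1 y x t = - ∫ s, g (t + y * s) * (1 + s ^ 2)⁻¹ := by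
  have h1 := Measure.integral_comp_mul_left (fun x => g (t + x) * zbK 1 y (t + x) t) y
  have h2 := integral_add_left_eq_self (μ := volume) (fun x => g x * zbK 1 y x t) t
  rw [h2, abs_of_pos (inv_pos.2 hy), smul_eq_mul] at h1
  rw [← integral_neg]
  have : ∫ x, g x * zbK 1 y x t = y * ∫ x, g (t + y * x) * zbK 1 y (t + y * x) t := by
    rw [h1]; field_simp
  rw [this, ← integral_const_mul]
  congr 1
  funext s
  rw [zbK_one]
  have : (1 + s ^ 2) ≠ 0 := by positivity
  have h4 : (t + y * s - t) ^ 2 + y ^ 2 = y ^ 2 * (1 + s ^ 2) := by ring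
  rw [h4]
  field_simp

lemma zb_scale_bound (g : ℝ → ℝ) (C : ℝ) (hC : ∀ x, ‖g x‖ ≤ C) (y t : ℝ) :
    ‖∫ s, g (t + y * s) * (1 + s ^ 2)⁻¹‖ ≤ C * Real.pi := by
  rw [← integral_univ_inv_one_add_sq, ← integral_const_mul]
  apply norm_integral_le_of_norm_le (integrable_inv_one_add_sq.const_mul C)
  refine ae_of_all _ fun s => ?_
  have : (0 : ℝ) ≤ (1 + s ^ 2)⁻¹ := by positivity
  rw [norm_mul, Real.norm_of_nonneg this]
  gcongr
  exact hC _

lemma zb_lim (g : ℝ → ℝ) (hg : Continuous g) (C : ℝ) (hC : ∀ x, ‖g x‖ ≤ C) (t : ℝ) :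
    Tendsto (fun y : ℝ => ∫ s, g (t + y * s) * (1 + s ^ 2)⁻¹) (𝓝[>] 0) (𝓝 (g t * Real.pi)) := by
  rw [← integral_univ_inv_one_add_sq, ← integral_const_mul]
  apply tendsto_integral_filter_of_dominated_convergence (fun s => C * (1 + s ^ 2)⁻¹)
  · refine Eventually.of_forall fun y => ?_
    apply AEStronglyMeasurable.mul
    · exact Continuous.aestronglyMeasurable (by fun_prop)
    · exact integrable_inv_one_add_sq.aestronglyMeasurable
  · refine Eventually.of_forall fun y => ae_of_all _ fun s => ?_
    have : (0 : ℝ) ≤ (1 + s ^ 2)⁻¹ := by positivity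
    rw [norm_mul, Real.norm_of_nonneg this]
    gcongr
    exact hC _
  · exact integrable_inv_one_add_sq.const_mul C
  · refine ae_of_all _ fun s => ?_
    apply Tendsto.mul_const
    have : Continuous fun y : ℝ => g (t + y * s) := by fun_prop
    have h := this.tendsto 0
    simp only [zero_mul, add_zero] at h
    exact h.mono_left nhdsWithin_le_nhds

lemma zb_lim2 (m : Measure ℝ) [IsFiniteMeasure m] (a : ℝ → ℝ) (ha : Integrable a m)
    (g : ℝ → ℝ) (hg : Continuous g) (hs : HasCompactSupport g) :
    Tendsto (fun y : ℝ => ∫ t, a t * (∫ x, g x * zbK 1 y x t) ∂m) (𝓝[>] 0)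
      (𝓝 (∫ t, a t * (-(g t * Real.pi)) ∂m)) := by
  obtain ⟨C, hC⟩ := hs.exists_bound_of_continuous hg
  have hgi : Integrable g := hg.integrable_of_hasCompactSupport hs
  apply tendsto_integral_filter_of_dominated_convergence (fun t => ‖a t‖ * (C * Real.pi))
  · filter_upwards [self_mem_nhdsWithin] with y hy
    apply ha.aestronglyMeasurable.mul
    have h : Integrable (Function.uncurry fun t x => zbK 1 y x t * g x)
        (m.prod (volume : Measure ℝ)) := by
      have h0 : Integrable (fun p : ℝ × ℝ => (1 : ℝ) * g p.2) (m.prod (volume : Measure ℝ)) :=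
        (integrable_const (1 : ℝ)).mul_prod hgi
      simp only [one_mul] at h0
      exact h0.bdd_mul ((zbK_cont 1 y hy).comp continuous_swap).aestronglyMeasurable
        (ae_of_all _ fun p => zbK_bound 1 y hy _ _)
    have := h.integral_prod_left.aestronglyMeasurable
    simpa [Function.uncurry, mul_comm] using this
  · filter_upwards [self_mem_nhdsWithin] with y hy
    refine ae_of_all _ fun t => ?_
    rw [norm_mul, zb_scale g y hy t, norm_neg]
    gcongr
    exact zb_scale_bound g C hC y t
  · exact ha.norm.mul_const _
  · refine ae_of_all _ fun t => ?_
    apply Tendsto.const_mul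
    refine (zb_lim g hg C hC t).neg.congr' ?_
    filter_upwards [self_mem_nhdsWithin] with y hy
    rw [zb_scale g y hy t]

lemma zb_parts (f : ℝ → ℝ) (hf : ContDiff ℝ (⊤ : ℕ∞) f) (hs : HasCompactSupport f)
    (y : ℝ) (hy : 0 < y) (t : ℝ) :
    ∫ x, f x * zbK 2 y x t = ∫ x, deriv f x * zbK 1 y x t := by
  have hd : Continuous (deriv f) := hf.continuous_deriv (by simp)
  have hk : ∀ n, Continuous fun x => zbK n y x t := fun n =>
    (zbK_cont n y hy).comp (by fun_prop : Continuous fun x : ℝ => (x, t))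
  have := integral_mul_deriv_eq_deriv_mul_of_integrable (u := f) (v := fun x => zbK 1 y x t)
    (u' := deriv f) (v' := fun x => -zbK 2 y x t)
    (fun x _ => (hf.differentiable (by simp) x).hasDerivAt) (fun x _ => zbK_deriv y hy x t)
    ((hf.continuous.mul (hk 2).neg).integrable_of_hasCompactSupport hs.mul_right)
    ((hd.mul (hk 1)).integrable_of_hasCompactSupport hs.deriv.mul_right)
    ((hf.continuous.mul (hk 1)).integrable_of_hasCompactSupport hs.mul_right)
  simp only [mul_neg, integral_neg, neg_inj] at this
  exact this

/-- the classical zero bias of μ is the law of U·W° + (1−U)·X° where U is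
uniform on [0,1] and W°, X° are independent with law μ° (the free zero bias of μ), all
mutually independent.  Formally: with ρ = μ° and ν the pushforward of
Leb_{[0,1]} ⊗ ρ ⊗ ρ under (u,w,x) ↦ u·w + (1−u)·x, the measure ν satisfies the
classical zero bias identity ∫ x f(x) dμ = σ² ∫ f′ dν for all f ∈ C_c^∞(ℝ). -/
theorem classical_zero_bias_as_interpolation (μ ρ : Measure ℝ)
    [IsProbabilityMeasure μ] [IsProbabilityMeasure ρ]
    (h1 : Integrable (fun t => t) μ) (hmean : (∫ t, t ∂μ) = 0)
    (h2 : Integrable (fun t => t ^ 2) μ) (hpos : 0 < ∫ t, t ^ 2 ∂μ)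
    (hρ : ∀ z : ℂ, 0 < z.im →
      (cauchy ρ z) ^ 2 = (z * cauchy μ z - 1) / ((∫ t, t ^ 2 ∂μ : ℝ) : ℂ))
    (ν : Measure ℝ)
    (hν : ν = Measure.map (fun p : ℝ × ℝ × ℝ => p.1 * p.2.1 + (1 - p.1) * p.2.2)
      ((volume.restrict (Set.Icc (0 : ℝ) 1)).prod (ρ.prod ρ))) :
    ∀ f : ℝ → ℝ, ContDiff ℝ (⊤ : ℕ∞) f → HasCompactSupport f →
      (∫ x, x * f x ∂μ) = (∫ t, t ^ 2 ∂μ) * ∫ t, deriv f t ∂ν := by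
  intro f hf hs
  have hfin : IsFiniteMeasure ν := by rw [hν]; infer_instance
  have hfi : Integrable f := hf.continuous.integrable_of_hasCompactSupport hs
  have hd : Continuous (deriv f) := hf.continuous_deriv (by simp)
  set v : ℝ := ∫ t, t ^ 2 ∂μ with hv
  have hvc : (v : ℂ) ≠ 0 := by exact_mod_cast hpos.ne'
  have key : ∀ y : ℝ, 0 < y → ∀ x : ℝ,
      ∫ t, zbK 1 y x t * t ∂μ = v * ∫ t, zbK 2 y x t * 1 ∂ν := by
    intro y hy x
    have hz : 0 < ((x : ℂ) + y * I).im := by simpa using hy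
    have h := hρ _ hz
    rw [eq_div_iff hvc, zb_L1 μ _ hz, zb_L2 ρ _ hz, ← hν] at h
    rw [zbK_int μ (fun t => t) h1 1 y hy x,
      zbK_int ν (fun _ => 1) (integrable_const 1) 2 y hy x, ← h]
    simp [mul_comm]
  have key2 : ∀ y : ℝ, 0 < y →
      ∫ t, t * (∫ x, f x * zbK 1 y x t) ∂μ
        = v * ∫ t, 1 * (∫ x, deriv f x * zbK 1 y x t) ∂ν := by
    intro y hy
    rw [← zb_fub μ (fun t => t) h1 f hfi 1 y hy]
    simp only [← zb_parts f hf hs y hy]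
    rw [← zb_fub ν (fun _ => 1) (integrable_const 1) f hfi 2 y hy, ← integral_const_mul]
    congr 1
    funext x
    rw [key y hy x]
    ring
  have l1 := zb_lim2 μ (fun t => t) h1 f hf.continuous hs
  have l2 := (zb_lim2 ν (fun _ => 1) (integrable_const 1) (deriv f) hd hs.deriv).const_mul v
  have e := tendsto_nhds_unique (l1.congr' (by
    filter_upwards [self_mem_nhdsWithin] with y hy
    exact key2 y hy)) l2
  simp only [mul_neg, integral_neg, one_mul, neg_inj, ← mul_assoc, integral_mul_const] at e
  exact mul_right_cancel₀ Real.pi_ne_zero e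
end
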